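/- Every maximal solution (u,v) of the planar system u' = v − 1/v, v' = −u with v(0) > 0 and H(u(0),v(0)) = c > 1/2 is defined on all of ℝ, satisfies v(t) > 0 for all t, and is periodic; its minimal period equals T(c) = √2·∫_{c₁(c)}^{c₂(c)} dv/√(c − φ(v)), where c₁(c) ∈ (0,1) and c₂(c) ∈ (1,∞) are the two roots of φ(v) = c, with φ(v) = v²/2 − log v. -/

import Mathlib

open Real intervalIntegral

open Set

/-- `(u, v)` solves `u' = v − 1/v`, `v' = −u` on `I`. -/
def IsSolOn (u v : ℝ → ℝ) (I : Set ℝ) : Prop :=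
  ∀ t ∈ I, HasDerivAt u (v t - 1 / v t) t ∧ HasDerivAt v (-(u t)) t

/-- The right-hand side of the system `u' = v − 1/v`, `v' = −u`. -/
noncomputable def planarField (p : ℝ × ℝ) : ℝ × ℝ := (p.2 - 1 / p.2, -p.1)

/-- The potential `φ(v) = v²/2 − log v`. -/
noncomputable def potential (v : ℝ) : ℝ := v ^ 2 / 2 - Real.log v

lemma potential_strictAntiOn : StrictAntiOn potential (Ioc 0 1) := by
  intro a ha b hb hab
  have h1 := Real.log_le_sub_one_of_pos (x := b / a) (div_pos hb.1 ha.1)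
  have h2 := Real.log_le_sub_one_of_pos (x := a / b) (div_pos ha.1 hb.1)
  rw [Real.log_div ha.1.ne' hb.1.ne'] at h2
  have h3 : a / b - 1 = -((b - a) / b) := by
    have := hb.1.ne'
    field_simp
    ring
  have h4 : b - a ≤ (b - a) / b := by
    rw [le_div_iff₀ hb.1]
    nlinarith [hb.2]
  unfold potential
  nlinarith [mul_pos (sub_pos.2 hab) (show 0 < 2 - (a + b) by linarith [hb.2])]

lemma potential_strictMonoOn : StrictMonoOn potential (Ici 1) := by
  intro a ha b hb hab
  have ha1 : (1 : ℝ) ≤ a := ha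
  have ha0 : 0 < a := by linarith
  have hb0 : 0 < b := by linarith
  have h2 := Real.log_le_sub_one_of_pos (x := b / a) (div_pos hb0 ha0)
  rw [Real.log_div hb0.ne' ha0.ne'] at h2
  have h3 : b / a - 1 = (b - a) / a := by
    field_simp
  have h4 : (b - a) / a ≤ b - a := by
    rw [div_le_iff₀ ha0]
    nlinarith
  unfold potential
  nlinarith [mul_pos (sub_pos.2 hab) (show 0 < a + b - 2 by linarith)]

lemma half_le_potential {v : ℝ} (hv : 0 < v) : 1 / 2 ≤ potential v := by
  have := Real.log_le_sub_one_of_pos hv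
  unfold potential
  nlinarith [sq_nonneg (v - 1)]

lemma mem_Icc_of_potential_le {c₁ c₂ w : ℝ} (hc₁ : c₁ ∈ Ioo (0 : ℝ) 1) (hc₂ : 1 < c₂)
    (h : potential c₁ = potential c₂) (hw : 0 < w) (hle : potential w ≤ potential c₁) :
    w ∈ Icc c₁ c₂ := by
  constructor
  · by_contra! hlt
    have := potential_strictAntiOn ⟨hw, by linarith [hc₁.2]⟩ ⟨hc₁.1, hc₁.2.le⟩ hlt
    linarith
  · by_contra! hlt
    have := potential_strictMonoOn (mem_Ici.2 hc₂.le) (mem_Ici.2 (hc₂.trans hlt).le) hlt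
    linarith

lemma eq_or_eq_of_potential_eq {c₁ c₂ w : ℝ} (hc₁ : c₁ ∈ Ioo (0 : ℝ) 1) (hc₂ : 1 < c₂)
    (h : potential c₁ = potential c₂) (hw : 0 < w) (heq : potential w = potential c₁) :
    w = c₁ ∨ w = c₂ := by
  rcases le_total w 1 with h1 | h1
  · exact Or.inl (potential_strictAntiOn.injOn ⟨hw, h1⟩ ⟨hc₁.1, hc₁.2.le⟩ heq)
  · exact Or.inr (potential_strictMonoOn.injOn (mem_Ici.2 h1) (mem_Ici.2 hc₂.le) (heq.trans h))

lemma IsSolOn.hasDerivAt_prodMk {u v : ℝ → ℝ} {I : Set ℝ} (h : IsSolOn u v I) {t : ℝ}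
    (ht : t ∈ I) : HasDerivAt (fun s => (u s, v s)) (planarField (u t, v t)) t :=
  (h t ht).1.prodMk (h t ht).2

/-- The exponential form `v · exp(−(u² + v²)/2)` of the energy is conserved; in particular
`v` cannot vanish. -/
lemma IsSolOn.mul_exp_eq {u v : ℝ → ℝ} {I : Set ℝ} (h : IsSolOn u v I) (hI : IsOpen I)
    (hIc : I.OrdConnected) {t₀ : ℝ} (ht₀ : t₀ ∈ I) (hv : 0 < v t₀) {t : ℝ} (ht : t ∈ I) :
    v t * Real.exp (-(u t ^ 2 + v t ^ 2) / 2) =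
      v t₀ * Real.exp (-(u t₀ ^ 2 + v t₀ ^ 2) / 2) := by
  set g : ℝ → ℝ := fun s => v s * Real.exp (-(u s ^ 2 + v s ^ 2) / 2) with hg
  have hg0 : 0 < g t₀ := mul_pos hv (Real.exp_pos _)
  have hcont : ∀ s ∈ I, ContinuousAt g s := fun s hs => by
    have h1 := (h s hs).1.continuousAt
    have h2 := (h s hs).2.continuousAt
    fun_prop
  have hder : ∀ s ∈ I, v s ≠ 0 → HasDerivAt g 0 s := fun s hs hvs => by
    have h1 := (h s hs).1
    have h2 := (h s hs).2
    have := h2.mul ((((h1.pow 2).add (h2.pow 2)).neg.div_const 2).exp)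
    refine this.congr_deriv ?_
    simp only [Pi.add_apply, Pi.pow_apply, Pi.neg_apply]
    field_simp
    ring
  have hloc : ∀ s ∈ I, g s = g t₀ → ∀ᶠ r in nhds s, r ∈ I ∧ g r = g t₀ := by
    intro s hs hgs
    have hvs : v s ≠ 0 := by
      intro h0
      simp only [hg, h0, zero_mul] at hgs
      exact hg0.ne hgs
    have hev : ∀ᶠ r in nhds s, r ∈ I ∧ v r ≠ 0 :=
      (show ∀ᶠ r in nhds s, r ∈ I from hI.mem_nhds hs).and ((h s hs).2.continuousAt.eventually_ne hvs)
    obtain ⟨ε, hε, hball⟩ := Metric.eventually_nhds_iff_ball.1 hev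
    refine Metric.eventually_nhds_iff_ball.2 ⟨ε, hε, fun r hr => ⟨(hball r hr).1, ?_⟩⟩
    rw [← hgs]
    exact Metric.isOpen_ball.is_const_of_deriv_eq_zero
      (convex_ball s ε).isPreconnected
      (fun x hx => (hder x (hball x hx).1 (hball x hx).2).differentiableAt.differentiableWithinAt)
      (fun x hx => (hder x (hball x hx).1 (hball x hx).2).deriv) hr (Metric.mem_ball_self hε)
  have hsub : I ⊆ {s | s ∈ I ∧ g s = g t₀} := by
    apply hIc.isPreconnected.subset_of_closure_inter_subset
    · exact isOpen_iff_mem_nhds.2 fun s hs => hloc s hs.1 hs.2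
    · exact ⟨t₀, ht₀, ht₀, rfl⟩
    · rintro s ⟨hs, hsI⟩
      refine ⟨hsI, ?_⟩
      by_contra hne
      have hev := (hcont s hsI).eventually_ne hne
      obtain ⟨r, hr, hr'⟩ := (mem_closure_iff_frequently.1 hs).and_eventually hev |>.exists
      exact hr' hr.2
  exact (hsub ht).2

lemma IsSolOn.pos {u v : ℝ → ℝ} {I : Set ℝ} (h : IsSolOn u v I) (hI : IsOpen I)
    (hIc : I.OrdConnected) {t₀ : ℝ} (ht₀ : t₀ ∈ I) (hv : 0 < v t₀) {t : ℝ} (ht : t ∈ I) :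
    0 < v t := by
  have := h.mul_exp_eq hI hIc ht₀ hv ht
  have h2 : 0 < v t * Real.exp (-(u t ^ 2 + v t ^ 2) / 2) :=
    this ▸ mul_pos hv (Real.exp_pos _)
  exact pos_of_mul_pos_left h2 (Real.exp_pos _).le

lemma IsSolOn.energy_eq {u v : ℝ → ℝ} {I : Set ℝ} (h : IsSolOn u v I) (hI : IsOpen I)
    (hIc : I.OrdConnected) {t₀ : ℝ} (ht₀ : t₀ ∈ I) (hv : 0 < v t₀) {t : ℝ} (ht : t ∈ I) :
    u t ^ 2 / 2 + potential (v t) = u t₀ ^ 2 / 2 + potential (v t₀) := by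
  have h1 := congrArg Real.log (h.mul_exp_eq hI hIc ht₀ hv ht)
  rw [Real.log_mul (h.pos hI hIc ht₀ hv ht).ne' (Real.exp_ne_zero _),
    Real.log_mul hv.ne' (Real.exp_ne_zero _), Real.log_exp, Real.log_exp] at h1
  unfold potential
  linarith

lemma planarField_lipschitzOnWith {δ : ℝ} (hδ : 0 < δ) :
    LipschitzOnWith (1 + 1 / δ ^ 2).toNNReal planarField {p | δ ≤ p.2} := by
  refine LipschitzOnWith.of_dist_le_mul fun p hp q hq => ?_
  have hp : δ ≤ p.2 := hp
  have hq : δ ≤ q.2 := hq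
  have hp0 : 0 < p.2 := by linarith
  have hq0 : 0 < q.2 := by linarith
  have hK : 0 < 1 / δ ^ 2 := by positivity
  rw [Real.coe_toNNReal _ (by positivity), Prod.dist_eq, Prod.dist_eq]
  have hm1 : dist p.1 q.1 ≤ max (dist p.1 q.1) (dist p.2 q.2) := le_max_left _ _
  have hm2 : dist p.2 q.2 ≤ max (dist p.1 q.1) (dist p.2 q.2) := le_max_right _ _
  have hm0 : 0 ≤ max (dist p.1 q.1) (dist p.2 q.2) := dist_nonneg.trans hm1
  refine max_le ?_ ?_
  · have h1 : (planarField p).1 - (planarField q).1 = (1 + 1 / (p.2 * q.2)) * (p.2 - q.2) := by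
      simp only [planarField]
      field_simp
      ring
    have h2 : 1 / (p.2 * q.2) ≤ 1 / δ ^ 2 := by
      apply one_div_le_one_div_of_le (by positivity)
      nlinarith
    have h3 : 0 < 1 / (p.2 * q.2) := by positivity
    rw [Real.dist_eq, h1, abs_mul, abs_of_pos (by positivity), ← Real.dist_eq]
    gcongr
  · have h1 : dist (planarField p).2 (planarField q).2 = dist p.1 q.1 := by
      simp [planarField]
    rw [h1]
    nlinarith

lemma IsSolOn.eqOn {u v u' v' : ℝ → ℝ} {I : Set ℝ} {δ : ℝ} (hδ : 0 < δ) (h : IsSolOn u v I)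
    (h' : IsSolOn u' v' I) (hI : IsOpen I) (hIc : I.OrdConnected)
    (hv : ∀ t ∈ I, δ ≤ v t) (hv' : ∀ t ∈ I, δ ≤ v' t) {t₀ : ℝ} (ht₀ : t₀ ∈ I)
    (hu0 : u t₀ = u' t₀) (hv0 : v t₀ = v' t₀) {t : ℝ} (ht : t ∈ I) :
    u t = u' t ∧ v t = v' t := by
  have hmin : min t t₀ ∈ I := by rcases min_choice t t₀ with h | h <;> rw [h] <;> assumption
  have hmax : max t t₀ ∈ I := by rcases max_choice t t₀ with h | h <;> rw [h] <;> assumption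
  obtain ⟨ε₁, hε₁, hb₁⟩ := Metric.isOpen_iff.1 hI _ hmin
  obtain ⟨ε₂, hε₂, hb₂⟩ := Metric.isOpen_iff.1 hI _ hmax
  set a := min t t₀ - ε₁ / 2
  set b := max t t₀ + ε₂ / 2
  have ha : a ∈ I := hb₁ (by rw [Real.ball_eq_Ioo]; constructor <;> simp only [a] <;> linarith)
  have hb : b ∈ I := hb₂ (by rw [Real.ball_eq_Ioo]; constructor <;> simp only [b] <;> linarith)
  have hsub : Ioo a b ⊆ I := Ioo_subset_Icc_self.trans (hIc.out ha hb)
  have hat : t ∈ Ioo a b := by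
    constructor
    · linarith [min_le_left t t₀, show a = min t t₀ - ε₁ / 2 from rfl]
    · linarith [le_max_left t t₀, show b = max t t₀ + ε₂ / 2 from rfl]
  have hat₀ : t₀ ∈ Ioo a b := by
    constructor
    · linarith [min_le_right t t₀, show a = min t t₀ - ε₁ / 2 from rfl]
    · linarith [le_max_right t t₀, show b = max t t₀ + ε₂ / 2 from rfl]
  have := ODE_solution_unique_of_mem_Ioo (v := fun _ => planarField)
    (s := fun _ => {p : ℝ × ℝ | δ ≤ p.2}) (f := fun s => (u s, v s)) (g := fun s => (u' s, v' s))
    (fun _ _ => planarField_lipschitzOnWith hδ) hat₀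
    (fun s hs => ⟨h.hasDerivAt_prodMk (hsub hs), hv s (hsub hs)⟩)
    (fun s hs => ⟨h'.hasDerivAt_prodMk (hsub hs), hv' s (hsub hs)⟩)
    (by simp [hu0, hv0]) hat
  exact Prod.mk.inj this

/-- On a region `|u| ≤ M`, `δ ≤ v ≤ M` the local existence time is bounded below. -/
lemma exists_uniform_time {δ M : ℝ} (hδ : 0 < δ) (hM : 0 < M) :
    ∃ ε > 0, ∀ t₀ a b : ℝ, |a| ≤ M → δ ≤ b → b ≤ M → ∃ u v : ℝ → ℝ,
      u t₀ = a ∧ v t₀ = b ∧ IsSolOn u v (Ioo (t₀ - ε) (t₀ + ε)) := by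
  set r : ℝ := δ / 2 with hr
  have hr0 : 0 < r := by positivity
  set L : ℝ := M + r + 1 / r with hL
  have hL0 : 0 < L := by positivity
  refine ⟨r / L, by positivity, fun t₀ a b ha hb hbM => ?_⟩
  have hε : 0 < r / L := by positivity
  have hball : ∀ p ∈ Metric.closedBall (a, b) r, |p.1| ≤ M + r ∧ r ≤ p.2 ∧ p.2 ≤ M + r := by
    intro p hp
    rw [Metric.mem_closedBall, Prod.dist_eq, max_le_iff, Real.dist_eq, Real.dist_eq] at hp
    obtain ⟨h1, h2⟩ := hp
    rw [abs_le] at h1 h2 ha ⊢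
    refine ⟨⟨?_, ?_⟩, ?_, ?_⟩ <;> linarith
  have hpl : IsPicardLindelof (fun _ => planarField)
      (tmin := t₀ - r / L) (tmax := t₀ + r / L) ⟨t₀, by constructor <;> linarith⟩ (a, b)
      r.toNNReal 0 L.toNNReal (1 + 1 / r ^ 2).toNNReal := by
    constructor
    · intro t _
      refine (planarField_lipschitzOnWith hr0).mono fun p hp => ?_
      rw [Real.coe_toNNReal _ hr0.le] at hp
      exact (hball p hp).2.1
    · intro x _
      exact continuousOn_const
    · intro t _ p hp
      rw [Real.coe_toNNReal _ hr0.le] at hp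
      obtain ⟨h1, h2, h3⟩ := hball p hp
      rw [Real.coe_toNNReal _ hL0.le, Prod.norm_def]
      have hp0 : 0 < p.2 := by linarith
      have h4 : 1 / p.2 ≤ 1 / r := one_div_le_one_div_of_le hr0 h2
      have h5 : 0 < 1 / p.2 := by positivity
      have h6 : 0 < 1 / r := by positivity
      refine max_le ?_ ?_
      · simp only [planarField, Real.norm_eq_abs, abs_le]
        constructor <;> linarith
      · simp only [planarField, Real.norm_eq_abs, abs_neg]
        linarith
    · rw [Real.coe_toNNReal _ hr0.le, Real.coe_toNNReal _ hL0.le]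
      simp only [add_sub_cancel_left, sub_sub_cancel, max_self, NNReal.coe_zero, sub_zero]
      rw [mul_div_cancel₀ _ hL0.ne']
  obtain ⟨α, hα0, hα⟩ := hpl.exists_eq_forall_mem_Icc_hasDerivWithinAt₀
  refine ⟨fun t => (α t).1, fun t => (α t).2, ?_, ?_, fun t ht => ?_⟩
  · exact congrArg Prod.fst hα0
  · exact congrArg Prod.snd hα0
  · have hd : HasDerivAt α (planarField (α t)) t :=
      (hα t (Ioo_subset_Icc_self ht)).hasDerivAt (Icc_mem_nhds ht.1 ht.2)
    exact ⟨hd.fst, hd.snd⟩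

/-- Sturm comparison with `sin`: a solution of `f'' = −(1 + q) f` with `q ≥ 0` that is nonnegative
on an interval of length `π` vanishes at its ends. -/
lemma sturm_comparison {f p q : ℝ → ℝ} {a : ℝ} (hf : ∀ t, HasDerivAt f (p t) t)
    (hp : ∀ t, HasDerivAt p (-((1 + q t) * f t)) t) (hq : ∀ t, 0 ≤ q t)
    (hnn : ∀ t ∈ Icc a (a + π), 0 ≤ f t) : f a + f (a + π) ≤ 0 := by
  set W : ℝ → ℝ := fun t => p t * Real.sin (t - a) - f t * Real.cos (t - a) with hW
  have hd : ∀ t, HasDerivAt W (-(q t * f t * Real.sin (t - a))) t := by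
    intro t
    have hs : HasDerivAt (fun s => s - a) 1 t := (hasDerivAt_id t).sub_const a
    refine (((hp t).mul hs.sin).sub ((hf t).mul hs.cos)).congr_deriv ?_
    ring
  have hanti : AntitoneOn W (Icc a (a + π)) := by
    apply antitoneOn_of_deriv_nonpos (convex_Icc _ _)
    · exact fun t _ => (hd t).continuousAt.continuousWithinAt
    · exact fun t _ => (hd t).differentiableAt.differentiableWithinAt
    · intro t ht
      rw [interior_Icc] at ht
      rw [(hd t).deriv, neg_nonpos]
      have := Real.sin_nonneg_of_nonneg_of_le_pi (x := t - a) (by linarith [ht.1])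
        (by linarith [ht.2])
      exact mul_nonneg (mul_nonneg (hq t) (hnn t (Ioo_subset_Icc_self ht))) this
  have := hanti (left_mem_Icc.2 (by linarith [Real.pi_pos]))
    (right_mem_Icc.2 (by linarith [Real.pi_pos])) (by linarith [Real.pi_pos])
  simp only [hW, add_sub_cancel_left, sub_self, Real.sin_pi, Real.cos_pi, Real.sin_zero,
    Real.cos_zero] at this
  linarith

lemma IsSolOn.reflect {u v : ℝ → ℝ} {δ : ℝ} (hδ : 0 < δ) (h : IsSolOn u v univ)
    (hv : ∀ t, δ ≤ v t) {t₁ : ℝ} (h0 : u t₁ = 0) (t : ℝ) :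
    u (2 * t₁ - t) = -u t ∧ v (2 * t₁ - t) = v t := by
  have h' : IsSolOn (fun s => -u (2 * t₁ - s)) (fun s => v (2 * t₁ - s)) univ := by
    intro s _
    have hs : HasDerivAt (fun r => 2 * t₁ - r) (-1) s := (hasDerivAt_id s).const_sub _
    have h1 := ((h (2 * t₁ - s) trivial).1.comp s hs).neg
    have h2 := (h (2 * t₁ - s) trivial).2.comp s hs
    exact ⟨h1.congr_deriv (by ring), h2.congr_deriv (by ring)⟩
  have ht₁ : 2 * t₁ - t₁ = t₁ := by ring
  obtain ⟨h1, h2⟩ := h.eqOn hδ h' isOpen_univ ordConnected_univ (fun s _ => hv s)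
    (fun s _ => hv _) (mem_univ t₁) (by simp [ht₁, h0]) (by simp [ht₁]) (mem_univ t)
  exact ⟨by linarith, h2.symm⟩

lemma IsSolOn.hasDerivAt_field {u v : ℝ → ℝ} (h : IsSolOn u v univ) (hv : ∀ t, 0 < v t) (t : ℝ) :
    HasDerivAt (fun s => v s - 1 / v s) (-((1 + 1 / v t ^ 2) * u t)) t := by
  have h2 := (h t trivial).2
  have h0 := (hv t).ne'
  have := h2.sub ((hasDerivAt_const t (1 : ℝ)).div h2 h0)
  refine this.congr_deriv ?_
  field_simp
  ring

/-- The component `u` has a maximal interval of negativity. -/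
lemma IsSolOn.exists_neg_Ioo {u v : ℝ → ℝ} (h : IsSolOn u v univ) (hv : ∀ t, 0 < v t)
    (hE : 1 / 2 < u 0 ^ 2 / 2 + potential (v 0)) :
    ∃ t₀ t₁, t₀ < t₁ ∧ u t₀ = 0 ∧ u t₁ = 0 ∧ ∀ t ∈ Ioo t₀ t₁, u t < 0 := by
  have hf := h.hasDerivAt_field hv
  have hq : ∀ t, 0 ≤ 1 / v t ^ 2 := fun t => by positivity
  have hu : ∀ t, HasDerivAt u (v t - 1 / v t) t := fun t => (h t trivial).1
  have hcont : Continuous u := continuous_iff_continuousAt.2 fun t => (hu t).continuousAt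
  have hpi := Real.pi_pos
  have hpos : ∀ a, (∀ t ∈ Icc a (a + π), 0 ≤ u t) → u a + u (a + π) ≤ 0 := fun a ha =>
    sturm_comparison hu hf hq ha
  have hneg : ∀ a, ∃ t ∈ Icc a (a + π), 0 ≤ u t := by
    intro a
    by_contra! hlt
    have := sturm_comparison (f := fun t => -u t) (fun t => (hu t).neg)
      (fun t => (hf t).neg.congr_deriv (by ring)) hq
      (fun t ht => neg_nonneg.2 (hlt t ht).le)
    have h1 := hlt a (left_mem_Icc.2 (by linarith))
    have h2 := hlt (a + π) (right_mem_Icc.2 (by linarith))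
    linarith
  obtain ⟨s, hs⟩ : ∃ s, u s < 0 := by
    by_contra! hnn
    have hzero : ∀ t, u t = 0 := fun t => by
      linarith [hpos t (fun r _ => hnn r), hnn t, hnn (t + π)]
    have hu0 : u = fun _ => 0 := funext hzero
    have h1 := (hu 0).unique (hu0 ▸ hasDerivAt_const (0 : ℝ) (0 : ℝ))
    have hv0 := hv 0
    have hv1 : v 0 = 1 := by
      field_simp at h1
      nlinarith
    rw [hzero 0, hv1] at hE
    norm_num [potential] at hE
  have hclosed : IsClosed {t | 0 ≤ u t} := isClosed_le continuous_const hcont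
  set A := {t | 0 ≤ u t} ∩ Iic s with hA
  set B := {t | 0 ≤ u t} ∩ Ici s with hB
  have hAne : A.Nonempty := by
    obtain ⟨t, ht, hut⟩ := hneg (s - π)
    exact ⟨t, hut, by simpa using ht.2⟩
  have hBne : B.Nonempty := by
    obtain ⟨t, ht, hut⟩ := hneg s
    exact ⟨t, hut, ht.1⟩
  have hAb : BddAbove A := ⟨s, fun t ht => ht.2⟩
  have hBb : BddBelow B := ⟨s, fun t ht => ht.2⟩
  have hA1 := (hclosed.inter isClosed_Iic).csSup_mem hAne hAb
  have hB1 := (hclosed.inter isClosed_Ici).csInf_mem hBne hBb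
  rw [← hA] at hA1
  rw [← hB] at hB1
  have hA2 : 0 ≤ u (sSup A) := hA1.1
  have hB2 : 0 ≤ u (sInf B) := hB1.1
  have hAs : sSup A < s := lt_of_le_of_ne hA1.2 fun h => by rw [h] at hA2; linarith
  have hBs : s < sInf B := lt_of_le_of_ne hB1.2 fun h => by rw [← h] at hB2; linarith
  have hlt : ∀ t ∈ Ioo (sSup A) (sInf B), u t < 0 := by
    intro t ht
    by_contra! hnn
    rcases le_total t s with hts | hts
    · exact (le_csSup hAb ⟨hnn, hts⟩).not_gt ht.1
    · exact (csInf_le hBb ⟨hnn, hts⟩).not_gt ht.2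
  have hab : sSup A < sInf B := hAs.trans hBs
  have hle : ∀ t ∈ Icc (sSup A) (sInf B), u t ≤ 0 := by
    rw [← closure_Ioo hab.ne]
    exact fun t ht => closure_minimal (fun r hr => (hlt r hr).le)
      (isClosed_le hcont continuous_const) ht
  exact ⟨sSup A, sInf B, hab, le_antisymm (hle _ (left_mem_Icc.2 hab.le)) hA2,
    le_antisymm (hle _ (right_mem_Icc.2 hab.le)) hB2, hlt⟩

/-- A solution whose orbit lies in a compact part of the half-plane `v > 0` and which admits no
proper extension is global. -/
lemma IsSolOn.eq_univ_of_maximal {u v : ℝ → ℝ} {I : Set ℝ} {δ M : ℝ} (h : IsSolOn u v I)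
    (hI : IsOpen I) (hIc : I.OrdConnected) (hne : I.Nonempty) (hδ : 0 < δ) (hM : 0 < M)
    (hbound : ∀ (u' v' : ℝ → ℝ) (J : Set ℝ), IsSolOn u' v' J → IsOpen J → J.OrdConnected →
      ∀ t₀ ∈ I, t₀ ∈ J → u' t₀ = u t₀ → v' t₀ = v t₀ →
        ∀ t ∈ J, |u' t| ≤ M ∧ δ ≤ v' t ∧ v' t ≤ M)
    (hmax : ∀ J : Set ℝ, IsOpen J → J.OrdConnected → I ⊆ J → ∀ u' v' : ℝ → ℝ,
      (∀ t ∈ I, u' t = u t ∧ v' t = v t) → IsSolOn u' v' J → J = I) : I = univ := by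
  classical
  obtain ⟨ε, hε, hloc⟩ := exists_uniform_time hδ hM
  have hstep : ∀ t₀ ∈ I, Ioo (t₀ - ε) (t₀ + ε) ⊆ I := by
    intro t₀ ht₀
    set K := Ioo (t₀ - ε) (t₀ + ε) with hK
    have ht₀K : t₀ ∈ K := by constructor <;> linarith
    obtain ⟨hb1, hb2, hb3⟩ := hbound u v I h hI hIc t₀ ht₀ ht₀ rfl rfl t₀ ht₀
    obtain ⟨x, y, hx, hy, hxy⟩ := hloc t₀ (u t₀) (v t₀) hb1 hb2 hb3
    have hbx := hbound x y K hxy isOpen_Ioo ordConnected_Ioo t₀ ht₀ ht₀K hx hy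
    have hbu := hbound u v I h hI hIc t₀ ht₀ ht₀ rfl rfl
    have hagree : ∀ t ∈ I ∩ K, u t = x t ∧ v t = y t := fun t ht =>
      IsSolOn.eqOn hδ (fun s (hs : s ∈ I ∩ K) => h s hs.1) (fun s hs => hxy s hs.2)
        (hI.inter isOpen_Ioo) (hIc.inter ordConnected_Ioo) (fun s hs => (hbu s hs.1).2.1)
        (fun s hs => (hbx s hs.2).2.1) ⟨ht₀, ht₀K⟩ hx.symm hy.symm ht
    set U : ℝ → ℝ := fun t => if t ∈ I then u t else x t with hU
    set V : ℝ → ℝ := fun t => if t ∈ I then v t else y t with hV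
    have hUI : ∀ t ∈ I, U t = u t ∧ V t = v t := fun t ht => by simp [hU, hV, ht]
    have hUK : ∀ t ∈ K, U t = x t ∧ V t = y t := fun t ht => by
      by_cases hti : t ∈ I
      · simpa [hU, hV, hti] using hagree t ⟨hti, ht⟩
      · simp [hU, hV, hti]
    have hsol : IsSolOn U V (I ∪ K) := by
      rintro t (ht | ht)
      · have e1 : U =ᶠ[nhds t] u := Filter.mem_of_superset (hI.mem_nhds ht) fun s hs => (hUI s hs).1
        have e2 : V =ᶠ[nhds t] v := Filter.mem_of_superset (hI.mem_nhds ht) fun s hs => (hUI s hs).2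
        rw [(hUI t ht).1, (hUI t ht).2]
        exact ⟨(h t ht).1.congr_of_eventuallyEq e1, (h t ht).2.congr_of_eventuallyEq e2⟩
      · have e1 : U =ᶠ[nhds t] x :=
          Filter.mem_of_superset (isOpen_Ioo.mem_nhds ht) fun s hs => (hUK s hs).1
        have e2 : V =ᶠ[nhds t] y :=
          Filter.mem_of_superset (isOpen_Ioo.mem_nhds ht) fun s hs => (hUK s hs).2
        rw [(hUK t ht).1, (hUK t ht).2]
        exact ⟨(hxy t ht).1.congr_of_eventuallyEq e1, (hxy t ht).2.congr_of_eventuallyEq e2⟩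
    have hconn : (I ∪ K).OrdConnected :=
      (IsPreconnected.union t₀ ht₀ ht₀K hIc.isPreconnected isPreconnected_Ioo).ordConnected
    have := hmax (I ∪ K) (hI.union isOpen_Ioo) hconn subset_union_left U V hUI hsol
    exact this ▸ subset_union_right
  have hclosed : IsClosed I := by
    refine isClosed_of_closure_subset fun t ht => ?_
    obtain ⟨s, hs, hd⟩ := Metric.mem_closure_iff.1 ht ε hε
    rw [Real.dist_eq, abs_lt] at hd
    exact hstep s hs ⟨by linarith, by linarith⟩
  exact IsClopen.eq_univ ⟨hclosed, hI⟩ hne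

/-- The energy integral over a half-turn of an orbit measures the elapsed time. -/
lemma IsSolOn.integral_eq {u v : ℝ → ℝ} {c t₀ t₁ : ℝ} (h : IsSolOn u v univ)
    (hE : ∀ t, u t ^ 2 / 2 + potential (v t) = c) (h01 : t₀ < t₁)
    (hneg : ∀ t ∈ Ioo t₀ t₁, u t < 0) :
    StrictMonoOn v (Icc t₀ t₁) ∧
      ∫ w in v t₀..v t₁, 1 / √(c - (w ^ 2 / 2 - Real.log w)) = √2 * (t₁ - t₀) := by
  have hcont : Continuous v :=
    continuous_iff_continuousAt.2 fun t => (h t trivial).2.continuousAt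
  have hmono : StrictMonoOn v (Icc t₀ t₁) := by
    apply strictMonoOn_of_deriv_pos (convex_Icc _ _) hcont.continuousOn
    intro t ht
    rw [interior_Icc] at ht
    rw [(h t trivial).2.deriv]
    linarith [hneg t ht]
  refine ⟨hmono, ?_⟩
  have hl := left_mem_Icc.2 h01.le
  have hr := right_mem_Icc.2 h01.le
  have himage : v '' Ioo t₀ t₁ = Ioo (v t₀) (v t₁) := by
    apply Subset.antisymm
    · rintro _ ⟨t, ht, rfl⟩
      exact ⟨hmono hl (Ioo_subset_Icc_self ht) ht.1, hmono (Ioo_subset_Icc_self ht) hr ht.2⟩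
    · exact intermediate_value_Ioo h01.le hcont.continuousOn
  rw [intervalIntegral.integral_of_le (hmono hl hr h01).le,
    MeasureTheory.integral_Ioc_eq_integral_Ioo, ← himage,
    MeasureTheory.integral_image_eq_integral_abs_deriv_smul measurableSet_Ioo
      (fun t _ => (h t trivial).2.hasDerivWithinAt)
      (hmono.injOn.mono Ioo_subset_Icc_self)]
  have hint : ∀ t ∈ Ioo t₀ t₁,
      |-u t| • (1 / √(c - (v t ^ 2 / 2 - Real.log (v t)))) = √2 := by
    intro t ht
    have h1 : c - (v t ^ 2 / 2 - Real.log (v t)) = (u t) ^ 2 / 2 := by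
      have := hE t
      unfold potential at this
      linarith
    have h2 : |u t| ≠ 0 := abs_ne_zero.2 (hneg t ht).ne
    rw [h1, Real.sqrt_div' _ (by norm_num), Real.sqrt_sq_eq_abs, abs_neg, smul_eq_mul]
    field_simp
  rw [MeasureTheory.setIntegral_congr_fun measurableSet_Ioo hint, MeasureTheory.setIntegral_const]
  simp [MeasureTheory.measureReal_def, h01.le, mul_comm]

/-- every maximal solution of `u' = v − 1/v, v' = −u` with
`v(0) > 0` and `H(u(0),v(0)) = c > 1/2` is global, keeps `v > 0`, and is
periodic with minimal period `T(c) = √2·∫_{c₁(c)}^{c₂(c)} dv/√(c − φ(v))`,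
where `φ(v) = v²/2 − log v` and `c₁(c) ∈ (0,1)`, `c₂(c) ∈ (1,∞)` are the two
roots of `φ(v) = c`. -/
theorem stmt_15 (c : ℝ) (hc : 1 / 2 < c) (c₁ c₂ : ℝ)
    (hc₁ : c₁ ∈ Set.Ioo (0:ℝ) 1) (hc₂ : c₂ ∈ Set.Ioi (1:ℝ))
    (hφ₁ : c₁ ^ 2 / 2 - Real.log c₁ = c) (hφ₂ : c₂ ^ 2 / 2 - Real.log c₂ = c)
    (I : Set ℝ) (hIopen : IsOpen I) (hIconn : I.OrdConnected) (h0I : (0:ℝ) ∈ I)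
    (u v : ℝ → ℝ)
    (hu : ∀ t ∈ I, HasDerivAt u (v t - 1 / v t) t)
    (hv : ∀ t ∈ I, HasDerivAt v (-(u t)) t)
    (hv0 : 0 < v 0)
    (hH : (1 / 2) * ((u 0) ^ 2 + (v 0) ^ 2 - Real.log ((v 0) ^ 2)) = c)
    -- maximality: the solution cannot be extended to any strictly larger open interval
    (hmax : ∀ J : Set ℝ, IsOpen J → J.OrdConnected → I ⊆ J →
      ∀ u' v' : ℝ → ℝ, (∀ t ∈ I, u' t = u t ∧ v' t = v t) →
        (∀ t ∈ J, HasDerivAt u' (v' t - 1 / v' t) t) →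
        (∀ t ∈ J, HasDerivAt v' (-(u' t)) t) → J = I) :
    I = Set.univ ∧ (∀ t : ℝ, 0 < v t) ∧
    Function.Periodic (fun t : ℝ => (u t, v t))
      (Real.sqrt 2 * ∫ w in c₁..c₂, 1 / Real.sqrt (c - (w ^ 2 / 2 - Real.log w))) ∧
    (∀ S : ℝ, 0 < S → Function.Periodic (fun t : ℝ => (u t, v t)) S →
      Real.sqrt 2 * ∫ w in c₁..c₂, 1 / Real.sqrt (c - (w ^ 2 / 2 - Real.log w)) ≤ S) := by
  have hsol : IsSolOn u v I := fun t ht => ⟨hu t ht, hv t ht⟩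
  have hE0 : u 0 ^ 2 / 2 + potential (v 0) = c := by
    rw [Real.log_pow] at hH
    unfold potential
    push_cast at hH
    linarith
  have hp₁ : potential c₁ = c := hφ₁
  have hp₂ : potential c₂ = c := hφ₂
  have hc₂' : 1 < c₂ := hc₂
  have hbound : ∀ (u' v' : ℝ → ℝ) (J : Set ℝ), IsSolOn u' v' J → IsOpen J → J.OrdConnected →
      ∀ t₀ ∈ I, t₀ ∈ J → u' t₀ = u t₀ → v' t₀ = v t₀ →
        ∀ t ∈ J, |u' t| ≤ c + c₂ ∧ c₁ ≤ v' t ∧ v' t ≤ c + c₂ := by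
    intro u' v' J hsol' hJ hJc t₀ ht₀ ht₀J hu0' hv0' t ht
    have hpos : 0 < v' t₀ := hv0' ▸ hsol.pos hIopen hIconn h0I hv0 ht₀
    have hpos' := hsol'.pos hJ hJc ht₀J hpos ht
    have hE := hsol'.energy_eq hJ hJc ht₀J hpos ht
    rw [hu0', hv0', hsol.energy_eq hIopen hIconn h0I hv0 ht₀, hE0] at hE
    have hmem := mem_Icc_of_potential_le hc₁ hc₂' (hp₁.trans hp₂.symm) hpos'
      (by linarith [sq_nonneg (u' t)])
    have hhalf := half_le_potential hpos'
    refine ⟨abs_le_of_sq_le_sq ?_ (by linarith), hmem.1, by linarith [hmem.2]⟩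
    nlinarith [sq_nonneg (c - 1)]
  obtain rfl : I = univ := hsol.eq_univ_of_maximal hIopen hIconn ⟨0, h0I⟩ hc₁.1
    (show 0 < c + c₂ by linarith) hbound
    fun J hJ hJc hIJ u' v' hagree hsol' =>
      hmax J hJ hJc hIJ u' v' hagree (fun t ht => (hsol' t ht).1) (fun t ht => (hsol' t ht).2)
  have hpos : ∀ t, 0 < v t := fun t => hsol.pos hIopen hIconn h0I hv0 (mem_univ t)
  have hE : ∀ t, u t ^ 2 / 2 + potential (v t) = c := fun t =>
    (hsol.energy_eq hIopen hIconn h0I hv0 (mem_univ t)).trans hE0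
  have hlow : ∀ t, c₁ ≤ v t := fun t =>
    (hbound u v univ hsol hIopen hIconn 0 h0I h0I rfl rfl t (mem_univ t)).2.1
  obtain ⟨t₀, t₁, h01, hu₀, hu₁, hneg⟩ := hsol.exists_neg_Ioo hpos (hE0.symm ▸ hc)
  obtain ⟨hmono, hint⟩ := hsol.integral_eq hE h01 hneg
  have hroot : ∀ t, u t = 0 → v t = c₁ ∨ v t = c₂ := fun t ht =>
    eq_or_eq_of_potential_eq hc₁ hc₂' (hp₁.trans hp₂.symm) (hpos t) (by
      have := hE t
      rw [ht] at this
      linarith)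
  have hlt : v t₀ < v t₁ := hmono (left_mem_Icc.2 h01.le) (right_mem_Icc.2 h01.le) h01
  have hv₀ : v t₀ = c₁ := (hroot t₀ hu₀).resolve_right fun h => by
    rcases hroot t₁ hu₁ with h' | h' <;> linarith [hc₁.2]
  have hv₁ : v t₁ = c₂ := (hroot t₁ hu₁).resolve_left fun h => by linarith
  rw [hv₀, hv₁] at hint
  have hT : √2 * ∫ w in c₁..c₂, 1 / √(c - (w ^ 2 / 2 - Real.log w)) = 2 * (t₁ - t₀) := by
    rw [hint, ← mul_assoc, Real.mul_self_sqrt (by norm_num)]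
  have hrefl₀ := hsol.reflect hc₁.1 hlow hu₀
  have hrefl₁ := hsol.reflect hc₁.1 hlow hu₁
  rw [hT]
  refine ⟨rfl, hpos, fun t => ?_, fun S hS hper => ?_⟩
  · have h0 := hrefl₀ t
    have h1 := hrefl₁ (2 * t₀ - t)
    have e : 2 * t₁ - (2 * t₀ - t) = t + 2 * (t₁ - t₀) := by ring
    rw [e, h0.1, h0.2, neg_neg] at h1
    exact Prod.ext h1.1 h1.2
  · by_contra! hlt'
    have hS' : v (t₀ + S) = c₁ := (congrArg Prod.snd (hper t₀)).trans hv₀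
    have hgt : ∀ t ∈ Ioc t₀ t₁, c₁ < v t := fun t ht =>
      hv₀ ▸ hmono (left_mem_Icc.2 h01.le) ⟨ht.1.le, ht.2⟩ ht.1
    rcases le_total (t₀ + S) t₁ with h | h
    · linarith [hgt (t₀ + S) ⟨by linarith, h⟩]
    · linarith [hgt (2 * t₁ - (t₀ + S)) ⟨by linarith, by linarith⟩, (hrefl₁ (t₀ + S)).2]
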